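/- Let θ1 = φ1∘λ with φ1 symmetric convex piecewise affine, (X̄,Ȳ) ∈ gph ∂θ1, and Ū ∈ 𝕆ⁿ(X̄) ∩ 𝕆ⁿ(Ȳ). Then H ∈ C(X̄+Ȳ; ∂θ1(X̄)) if and only if ⟨diag(Ūᵀ H Ū), aⁱ⟩ = ⟨diag(Ūᵀ H Ū), aʲ⟩ = max_{κ∈ι1(λ(X̄))} ⟨λ'(X̄;H), a^κ⟩ for all i,j ∈ η1(λ(X̄),λ(Ȳ)). Moreover, if H ∈ C(X̄+Ȳ; ∂θ1(X̄)), then: (i) for each l, Ūᵀ_{α^l} H Ū_{α^l} is block diagonal with respect to the partition {β^l_k}_{k=1}^{s_l}; (ii) ⟨λ'(X̄;H), aⁱ⟩ = ⟨λ'(X̄;H), aʲ⟩ = max_{κ∈ι1(λ(X̄))} ⟨λ'(X̄;H), a^κ⟩ for all i,j ∈ η1(λ(X̄),λ(Ȳ)); (iii) for each l and each k ∈ E^l, there exists a scalar ρ^l_k with (Ūᵀ_{α^l} H Ū_{α^l})_{β^l_k β^l_k} = ρ^l_k I_{|β^l_k|}. -/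

import Mathlib

open Matrix Filter Topology Set
open scoped Classical

noncomputable section

/-- The vector of eigenvalues of a symmetric matrix, in non-increasing order. -/
noncomputable def lamVec {n : ℕ} (X : Matrix (Fin n) (Fin n) ℝ) : Fin n → ℝ :=
  if h : X.IsHermitian then fun i => (h.eigenvalues ∘ Tuple.sort h.eigenvalues) i.rev else 0

/-- The set `𝕆ⁿ(X)` of orthogonal matrices giving an ordered eigenvalue decomposition of `X`. -/
def OSet {n : ℕ} (X : Matrix (Fin n) (Fin n) ℝ) : Set (Matrix (Fin n) (Fin n) ℝ) :=
  {U | Uᵀ * U = 1 ∧ X = U * Matrix.diagonal (lamVec X) * Uᵀ}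

/-- One-sided directional derivative of a scalar function. -/
noncomputable def dirDeriv {E : Type*} [AddCommMonoid E] [Module ℝ E] (f : E → ℝ) (x h : E) : ℝ :=
  limUnder (𝓝[>] (0:ℝ)) fun t => (f (x + t • h) - f x) / t

/-- Vector of one-sided directional derivatives of the ordered eigenvalues: `λ'(X;H)`. -/
noncomputable def lamDD {n : ℕ} (X H : Matrix (Fin n) (Fin n) ℝ) : Fin n → ℝ :=
  fun i => dirDeriv (fun Y => lamVec Y i) X H

/-- The max-of-affine convex piecewise affine function `φ(x) = max_i (⟨aⁱ,x⟩ - cᵢ)`. -/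
noncomputable def pwa {n p : ℕ} [NeZero p] (a : Fin p → Fin n → ℝ) (c : Fin p → ℝ)
    (x : Fin n → ℝ) : ℝ :=
  ⨆ i, (a i ⬝ᵥ x - c i)

/-- The active index set `ι(x̄)` of a max-of-affine function at `x̄`. -/
def iotaA {n p : ℕ} [NeZero p] (a : Fin p → Fin n → ℝ) (c : Fin p → ℝ)
    (x : Fin n → ℝ) : Set (Fin p) :=
  {i | a i ⬝ᵥ x - c i = pwa a c x}

/-- Frobenius inner product of two matrices. -/
def mip {n : ℕ} (A B : Matrix (Fin n) (Fin n) ℝ) : ℝ := (Aᵀ * B).trace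

/-- Convex subdifferential (over the space of symmetric matrices) of a real function. -/
def msubdiff {n : ℕ} (f : Matrix (Fin n) (Fin n) ℝ → ℝ) (X : Matrix (Fin n) (Fin n) ℝ) :
    Set (Matrix (Fin n) (Fin n) ℝ) :=
  {G | G.IsSymm ∧ ∀ Y : Matrix (Fin n) (Fin n) ℝ, Y.IsSymm → f X + mip G (Y - X) ≤ f Y}

/-- Moore–Penrose pseudo-inverse, via the four Penrose conditions. -/
noncomputable def mpInv {n : ℕ} (A : Matrix (Fin n) (Fin n) ℝ) : Matrix (Fin n) (Fin n) ℝ :=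
  Classical.epsilon fun B => A * B * A = A ∧ B * A * B = B ∧ (A * B)ᵀ = A * B ∧ (B * A)ᵀ = B * A

/-- The sigma-term function
`Υ_X(Y,H) = 2 ∑_l ⟨Λ(Y)_{αˡαˡ}, Uᵀ_{αˡ} H (X - v̄ₗ I)† H U_{αˡ}⟩` (written as a single sum
over eigenvalue indices). -/
noncomputable def Upsilon {n : ℕ} (X Y U H : Matrix (Fin n) (Fin n) ℝ) : ℝ :=
  2 * ∑ i, lamVec Y i *
    ((Uᵀ * H * mpInv (X - lamVec X i • (1 : Matrix (Fin n) (Fin n) ℝ)) * H * U) i i)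

/-- The index set `η₁(x̄,ȳ)`: active indices carrying a strictly positive weight in some
convex-combination representation of `ȳ` by the active `aⁱ`'s. -/
def etaA {n p : ℕ} [NeZero p] (a : Fin p → Fin n → ℝ) (c : Fin p → ℝ)
    (x y : Fin n → ℝ) : Set (Fin p) :=
  {i | ∃ u : Fin p → ℝ, (∀ j, 0 ≤ u j) ∧ (∀ j, j ∉ iotaA a c x → u j = 0) ∧
        (∑ j, u j) = 1 ∧ y = ∑ j, u j • a j ∧ 0 < u i}

/-- `i` and `j` belong to the same block `αˡ` of `X̄`. -/
def sameA {n : ℕ} (X : Matrix (Fin n) (Fin n) ℝ) (i j : Fin n) : Prop :=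
  lamVec X i = lamVec X j

/-- `i` and `j` belong to the same sub-block `βˡₖ` (determined by the eigenvalues of both `X̄`
and `Ȳ`). -/
def sameB {n : ℕ} (X Y : Matrix (Fin n) (Fin n) ℝ) (i j : Fin n) : Prop :=
  lamVec X i = lamVec X j ∧ lamVec Y i = lamVec Y j

/-- The sub-block `βˡₖ` containing `i` is a "bad" block, i.e. `k ∈ Eˡ`: some `a^w`,
`w ∈ η₁(λ(X̄),λ(Ȳ))`, is non-constant on it. -/
def badB {n p : ℕ} [NeZero p] (a : Fin p → Fin n → ℝ) (c : Fin p → ℝ)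
    (X Y : Matrix (Fin n) (Fin n) ℝ) (i : Fin n) : Prop :=
  ∃ z z' : Fin n, sameB X Y z i ∧ sameB X Y z' i ∧
    ∃ w ∈ etaA a c (lamVec X) (lamVec Y), a w z ≠ a w z'

lemma lam_antitone {n : ℕ} (X : Matrix (Fin n) (Fin n) ℝ) : Antitone (lamVec X) := by
  unfold lamVec
  split_ifs with h
  · intro i j hij
    exact Tuple.monotone_sort h.eigenvalues (Fin.rev_le_rev.mpr hij)
  · intro i j _
    exact le_rfl

lemma symm_herm {n : ℕ} {X : Matrix (Fin n) (Fin n) ℝ} (hX : X.IsSymm) : X.IsHermitian := by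
  unfold Matrix.IsHermitian
  rw [Matrix.conjTranspose_eq_transpose_of_trivial]
  exact hX

lemma exists_OSet {n : ℕ} {X : Matrix (Fin n) (Fin n) ℝ} (hX : X.IsSymm) : ∃ V, V ∈ OSet X := by
  have h := symm_herm hX
  have hs := h.spectral_theorem
  set W : Matrix (Fin n) (Fin n) ℝ := (h.eigenvectorUnitary : Matrix (Fin n) (Fin n) ℝ) with hW
  have hWW : Wᵀ * W = 1 := by
    have := Unitary.coe_star_mul_self h.eigenvectorUnitary
    rwa [Matrix.star_eq_conjTranspose, Matrix.conjTranspose_eq_transpose_of_trivial] at this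
  have hX2 : X = W * diagonal h.eigenvalues * Wᵀ := by
    rw [Unitary.conjStarAlgAut_apply] at hs
    rw [Matrix.star_eq_conjTranspose, Matrix.conjTranspose_eq_transpose_of_trivial] at hs
    exact hs
  let τ : Fin n ≃ Fin n := Fin.revPerm.trans (Tuple.sort h.eigenvalues)
  have hl : lamVec X = h.eigenvalues ∘ τ := by
    unfold lamVec
    rw [dif_pos h]
    rfl
  refine ⟨W.submatrix id τ, ?_, ?_⟩
  · rw [Matrix.transpose_submatrix]
    ext i j
    have := congrFun (congrFun hWW (τ i)) (τ j)
    simp only [Matrix.mul_apply, Matrix.transpose_apply, Matrix.submatrix_apply, id] at this ⊢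
    rw [this, Matrix.one_apply, Matrix.one_apply]
    simp
  · rw [hl]
    conv_lhs => rw [hX2]
    ext i j
    rw [Matrix.mul_apply, Matrix.mul_apply]
    simp only [Matrix.mul_diagonal, Matrix.transpose_apply,
      Matrix.submatrix_apply, id, Function.comp]
    exact (Equiv.sum_comp τ (fun k => W i k * h.eigenvalues k * W j k)).symm

lemma orth_comm {n : ℕ} {Q : Matrix (Fin n) (Fin n) ℝ} (hQ : Qᵀ * Q = 1) : Q * Qᵀ = 1 :=
  mul_eq_one_comm.mp hQ

lemma birk {n : ℕ} {Q : Matrix (Fin n) (Fin n) ℝ} (hQ : Qᵀ * Q = 1) :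
    ∃ w : Equiv.Perm (Fin n) → ℝ, (∀ σ, 0 ≤ w σ) ∧ ∑ σ, w σ = 1 ∧
      ∀ x : Fin n → ℝ, (Qᵀ * diagonal x * Q).diag = ∑ σ, w σ • (x ∘ σ) := by
  have hQ' := orth_comm hQ
  let S : Matrix (Fin n) (Fin n) ℝ := fun i k => Q k i * Q k i
  have hS : S ∈ doublyStochastic ℝ (Fin n) := by
    rw [mem_doublyStochastic_iff_sum]
    refine ⟨fun i j => mul_self_nonneg _, fun i => ?_, fun j => ?_⟩
    · have := congrFun (congrFun hQ i) i
      simpa [Matrix.mul_apply] using this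
    · have := congrFun (congrFun hQ' j) j
      simpa [Matrix.mul_apply] using this
  obtain ⟨w, h0, h1, h2⟩ := exists_eq_sum_perm_of_mem_doublyStochastic hS
  refine ⟨w, h0, h1, fun x => ?_⟩
  have : (Qᵀ * diagonal x * Q).diag = S *ᵥ x := by
    ext i
    rw [Matrix.diag_apply, Matrix.mul_apply]
    simp only [Matrix.mul_diagonal, Matrix.transpose_apply, Matrix.mulVec, dotProduct, S]
    exact Finset.sum_congr rfl fun k _ => by ring
  rw [this, ← h2, Matrix.sum_mulVec]
  refine Finset.sum_congr rfl fun σ _ => ?_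
  rw [Matrix.smul_mulVec, Matrix.permMatrix_mulVec]

lemma le_pwa {n p : ℕ} [NeZero p] (a : Fin p → Fin n → ℝ) (c : Fin p → ℝ) (x : Fin n → ℝ)
    (i : Fin p) : a i ⬝ᵥ x - c i ≤ pwa a c x :=
  le_ciSup (f := fun i => a i ⬝ᵥ x - c i) (Set.finite_range _).bddAbove i

lemma pwa_le {n p : ℕ} [NeZero p] (a : Fin p → Fin n → ℝ) (c : Fin p → ℝ) (x : Fin n → ℝ)
    (M : ℝ) (h : ∀ i, a i ⬝ᵥ x - c i ≤ M) : pwa a c x ≤ M := ciSup_le h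

lemma iota_nonempty {n p : ℕ} [NeZero p] (a : Fin p → Fin n → ℝ) (c : Fin p → ℝ) (x : Fin n → ℝ) :
    ∃ i, i ∈ iotaA a c x := exists_eq_ciSup_of_finite (f := fun i => a i ⬝ᵥ x - c i)

lemma pwa_diag_le {n p : ℕ} [NeZero p] {a : Fin p → Fin n → ℝ} {c : Fin p → ℝ}
    (hsym : ∀ (σ : Equiv.Perm (Fin n)) (x : Fin n → ℝ), pwa a c (x ∘ σ) = pwa a c x)
    {Q : Matrix (Fin n) (Fin n) ℝ} (hQ : Qᵀ * Q = 1) (x : Fin n → ℝ) :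
    pwa a c (Qᵀ * diagonal x * Q).diag ≤ pwa a c x := by
  obtain ⟨w, h0, h1, h2⟩ := birk hQ
  rw [h2]
  refine pwa_le _ _ _ _ fun i => ?_
  calc a i ⬝ᵥ (∑ σ, w σ • (x ∘ σ)) - c i = ∑ σ, w σ * (a i ⬝ᵥ (x ∘ σ) - c i) := by
        simp only [dotProduct_sum, dotProduct_smul, smul_eq_mul, mul_sub, Finset.sum_sub_distrib]
        rw [← Finset.sum_mul, h1, one_mul]
    _ ≤ ∑ σ, w σ * pwa a c x := by
        refine Finset.sum_le_sum fun σ _ => mul_le_mul_of_nonneg_left ?_ (h0 σ)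
        rw [← hsym σ x]
        exact le_pwa a c _ i
    _ = pwa a c x := by rw [← Finset.sum_mul, h1, one_mul]

lemma dot_diag_le {n : ℕ} {Q : Matrix (Fin n) (Fin n) ℝ} (hQ : Qᵀ * Q = 1) {x y : Fin n → ℝ}
    (hx : Antitone x) (hy : Antitone y) :
    y ⬝ᵥ (Qᵀ * diagonal x * Q).diag ≤ y ⬝ᵥ x := by
  obtain ⟨w, h0, h1, h2⟩ := birk hQ
  rw [h2]
  calc y ⬝ᵥ (∑ σ, w σ • (x ∘ σ)) = ∑ σ, w σ * (y ⬝ᵥ (x ∘ σ)) := by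
        simp only [dotProduct_sum, dotProduct_smul, smul_eq_mul]
    _ ≤ ∑ σ, w σ * (y ⬝ᵥ x) := by
        refine Finset.sum_le_sum fun σ _ => mul_le_mul_of_nonneg_left ?_ (h0 σ)
        exact (hy.monovary hx).sum_mul_comp_perm_le_sum_mul
    _ = y ⬝ᵥ x := by rw [← Finset.sum_mul, h1, one_mul]

lemma diag_repr {n : ℕ} {A : Matrix (Fin n) (Fin n) ℝ} (hA : A.IsSymm)
    {V : Matrix (Fin n) (Fin n) ℝ} (hV : Vᵀ * V = 1) :
    ∃ Q : Matrix (Fin n) (Fin n) ℝ, Qᵀ * Q = 1 ∧ Vᵀ * A * V = Qᵀ * diagonal (lamVec A) * Q := by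
  obtain ⟨W, hW, hA'⟩ := exists_OSet hA
  have hW' := orth_comm hW
  refine ⟨Wᵀ * V, ?_, ?_⟩
  · rw [Matrix.transpose_mul, Matrix.transpose_transpose, Matrix.mul_assoc, ← Matrix.mul_assoc W,
      hW', Matrix.one_mul, hV]
  · conv_lhs => rw [hA']
    simp only [Matrix.transpose_mul, Matrix.transpose_transpose, Matrix.mul_assoc]

lemma pwa_diag_le_lam {n p : ℕ} [NeZero p] {a : Fin p → Fin n → ℝ} {c : Fin p → ℝ}
    (hsym : ∀ (σ : Equiv.Perm (Fin n)) (x : Fin n → ℝ), pwa a c (x ∘ σ) = pwa a c x)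
    {A V : Matrix (Fin n) (Fin n) ℝ} (hA : A.IsSymm) (hV : Vᵀ * V = 1) :
    pwa a c (Vᵀ * A * V).diag ≤ pwa a c (lamVec A) := by
  obtain ⟨Q, hQ, h⟩ := diag_repr hA hV
  rw [h]
  exact pwa_diag_le hsym hQ _

lemma dot_diag_le_lam {n : ℕ} {A V : Matrix (Fin n) (Fin n) ℝ} (hA : A.IsSymm) (hV : Vᵀ * V = 1)
    {y : Fin n → ℝ} (hy : Antitone y) : y ⬝ᵥ (Vᵀ * A * V).diag ≤ y ⬝ᵥ lamVec A := by
  obtain ⟨Q, hQ, h⟩ := diag_repr hA hV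
  rw [h]
  exact dot_diag_le hQ (lam_antitone A) hy

lemma lam_eq_diag {n : ℕ} {A V : Matrix (Fin n) (Fin n) ℝ} (hV : V ∈ OSet A) :
    Vᵀ * A * V = diagonal (lamVec A) := by
  obtain ⟨h1, h2⟩ := hV
  conv_lhs => rw [h2]
  rw [← Matrix.mul_assoc, ← Matrix.mul_assoc, h1, Matrix.one_mul, Matrix.mul_assoc, h1,
    Matrix.mul_one]

lemma symm_line {n : ℕ} {X H : Matrix (Fin n) (Fin n) ℝ} (hX : X.IsSymm) (hH : H.IsSymm) (t : ℝ) :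
    (X + t • H).IsSymm := hX.add (hH.smul t)

lemma convex_dot_lam {n : ℕ} {X H : Matrix (Fin n) (Fin n) ℝ} (hX : X.IsSymm) (hH : H.IsSymm)
    {y : Fin n → ℝ} (hy : Antitone y) :
    ConvexOn ℝ Set.univ (fun t : ℝ => y ⬝ᵥ lamVec (X + t • H)) := by
  refine ⟨convex_univ, fun s _ t _ α β hα hβ hαβ => ?_⟩
  obtain ⟨V, hV⟩ := exists_OSet (symm_line hX hH (α • s + β • t))
  have h0 := lam_eq_diag hV
  have hs := dot_diag_le_lam (symm_line hX hH s) hV.1 hy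
  have ht := dot_diag_le_lam (symm_line hX hH t) hV.1 hy
  have e : X + (α • s + β • t) • H = α • (X + s • H) + β • (X + t • H) := by
    have : X = α • X + β • X := by rw [← add_smul, hαβ, one_smul]
    conv_lhs => rw [this]
    simp only [smul_add, add_smul, smul_smul, smul_eq_mul]
    abel
  have h1 : lamVec (X + (α • s + β • t) • H) =
      α • (Vᵀ * (X + s • H) * V).diag + β • (Vᵀ * (X + t • H) * V).diag := by
    have : lamVec (X + (α • s + β • t) • H) = (Vᵀ * (X + (α • s + β • t) • H) * V).diag := by
      rw [h0]; simp
    rw [this, e]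
    ext i
    simp [Matrix.mul_add, Matrix.add_mul]
  show y ⬝ᵥ lamVec (X + (α • s + β • t) • H) ≤ α • (y ⬝ᵥ lamVec (X + s • H)) +
    β • (y ⬝ᵥ lamVec (X + t • H))
  rw [h1, dotProduct_add, dotProduct_smul, dotProduct_smul]
  simp only [smul_eq_mul]
  gcongr

lemma lam_tendsto {n : ℕ} {X H : Matrix (Fin n) (Fin n) ℝ} (hX : X.IsSymm) (hH : H.IsSymm)
    (i : Fin n) : Tendsto (fun t : ℝ => (lamVec (X + t • H) i - lamVec X i) / t) (𝓝[>] 0)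
      (𝓝 (lamDD X H i)) := by
  have key : ∀ y : Fin n → ℝ, Antitone y → ∃ L, Tendsto
      (fun t : ℝ => (y ⬝ᵥ lamVec (X + t • H) - y ⬝ᵥ lamVec X) / t) (𝓝[>] 0) (𝓝 L) := by
    intro y hy
    have h := (convex_dot_lam hX hH hy).hasDerivWithinAt_rightDeriv_of_mem_interior
      (x := 0) (by simp)
    rw [hasDerivWithinAt_iff_tendsto_slope' self_notMem_Ioi] at h
    refine ⟨_, h.congr fun t => ?_⟩
    simp [slope_def_field]
  obtain ⟨L1, h1⟩ := key (fun j => if j ≤ i then 1 else 0) (by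
    intro j k hjk
    dsimp only
    split_ifs with ha hb <;> norm_num
    exact hb (hjk.trans ha))
  obtain ⟨L2, h2⟩ := key (fun j => if j < i then 1 else 0) (by
    intro j k hjk
    dsimp only
    split_ifs with ha hb <;> norm_num
    exact hb (hjk.trans_lt ha))
  have e : ∀ z : Fin n → ℝ, z i = (fun j => if j ≤ i then (1:ℝ) else 0) ⬝ᵥ z -
      (fun j => if j < i then (1:ℝ) else 0) ⬝ᵥ z := by
    intro z
    rw [← sub_dotProduct]
    have : ((fun j => if j ≤ i then (1:ℝ) else 0) - (fun j => if j < i then (1:ℝ) else 0)) =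
        Pi.single i 1 := by
      ext j
      rcases lt_trichotomy j i with h | h | h
      · simp [h.le, h, h.ne]
      · simp [h]
      · simp [h.not_ge, h.not_gt, h.ne']
    rw [this]; simp
  have h3 : Tendsto (fun t : ℝ => (lamVec (X + t • H) i - lamVec X i) / t) (𝓝[>] 0)
      (𝓝 (L1 - L2)) := by
    refine (h1.sub h2).congr fun t => ?_
    rw [e (lamVec (X + t • H)), e (lamVec X)]
    ring
  have : lamDD X H i = L1 - L2 := h3.limUnder_eq
  rw [this]
  exact h3

lemma pwa_tendsto {n p : ℕ} [NeZero p] (a : Fin p → Fin n → ℝ) (c : Fin p → ℝ) (x μ : Fin n → ℝ)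
    (γ : ℝ → Fin n → ℝ)
    (hγ : ∀ i, Tendsto (fun t : ℝ => (γ t i - x i) / t) (𝓝[>] 0) (𝓝 (μ i))) (M : ℝ)
    (hM : IsGreatest {t : ℝ | ∃ κ ∈ iotaA a c x, t = μ ⬝ᵥ a κ} M) :
    Tendsto (fun t : ℝ => (pwa a c (γ t) - pwa a c x) / t) (𝓝[>] 0) (𝓝 M) := by
  have hpos : ∀ᶠ t : ℝ in 𝓝[>] 0, 0 < t := eventually_mem_nhdsWithin
  have hd : ∀ i, Tendsto (fun t : ℝ => (a i ⬝ᵥ γ t - a i ⬝ᵥ x) / t) (𝓝[>] 0)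
      (𝓝 (μ ⬝ᵥ a i)) := by
    intro i
    have : Tendsto (fun t : ℝ => ∑ k, a i k * ((γ t k - x k) / t)) (𝓝[>] 0)
        (𝓝 (∑ k, a i k * μ k)) :=
      tendsto_finsetSum _ fun k _ => (hγ k).const_mul _
    rw [dotProduct_comm μ]
    refine Tendsto.congr (fun t => ?_) this
    rw [← dotProduct_sub]
    simp only [dotProduct, Finset.sum_div, Pi.sub_apply]
    exact Finset.sum_congr rfl fun k _ => by ring
  rw [tendsto_order]
  constructor
  · intro b hb
    obtain ⟨κ, hκ, rfl⟩ := hM.1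
    filter_upwards [(hd κ).eventually_const_lt hb, hpos] with t ht ht0
    refine ht.trans_le ?_
    have h1 : a κ ⬝ᵥ x - c κ = pwa a c x := hκ
    have h2 := le_pwa a c (γ t) κ
    exact div_le_div_of_nonneg_right (by linarith) ht0.le
  · intro b hb
    have hall : ∀ i, ∀ᶠ t : ℝ in 𝓝[>] 0, (a i ⬝ᵥ γ t - c i - pwa a c x) / t < b := by
      intro i
      by_cases hi : i ∈ iotaA a c x
      · have h1 : a i ⬝ᵥ x - c i = pwa a c x := hi
        have h2 : μ ⬝ᵥ a i < b := (hM.2 ⟨i, hi, rfl⟩).trans_lt hb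
        filter_upwards [(hd i).eventually_lt_const h2] with t ht
        rw [← h1]
        have e : a i ⬝ᵥ γ t - c i - (a i ⬝ᵥ x - c i) = a i ⬝ᵥ γ t - a i ⬝ᵥ x := by ring
        rw [e]
        exact ht
      · have h1 : a i ⬝ᵥ x - c i - pwa a c x < 0 := by
          have h2 := le_pwa a c x i
          have h3 : a i ⬝ᵥ x - c i ≠ pwa a c x := hi
          have := lt_of_le_of_ne h2 h3
          linarith
        have h0 : Tendsto (fun t : ℝ => t) (𝓝[>] 0) (𝓝 0) := tendsto_id.mono_left nhdsWithin_le_nhds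
        have h4 : Tendsto (fun t : ℝ => t * ((a i ⬝ᵥ γ t - a i ⬝ᵥ x) / t) +
            (a i ⬝ᵥ x - c i - pwa a c x) - t * b) (𝓝[>] 0)
            (𝓝 (0 * (μ ⬝ᵥ a i) + (a i ⬝ᵥ x - c i - pwa a c x) - 0 * b)) :=
          ((h0.mul (hd i)).add tendsto_const_nhds).sub (h0.mul tendsto_const_nhds)
        have h5 : 0 * (μ ⬝ᵥ a i) + (a i ⬝ᵥ x - c i - pwa a c x) - 0 * b < 0 := by linarith
        filter_upwards [h4.eventually_lt_const h5, hpos] with t ht ht0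
        rw [div_lt_iff₀ ht0]
        rw [mul_div_cancel₀ _ ht0.ne'] at ht
        linarith
    filter_upwards [eventually_all.mpr hall, hpos] with t ht ht0
    rw [div_lt_iff₀ ht0]
    obtain ⟨i, hi⟩ := iota_nonempty a c (γ t)
    have h1 : a i ⬝ᵥ γ t - c i = pwa a c (γ t) := hi
    have := ht i
    rw [div_lt_iff₀ ht0] at this
    linarith

lemma exists_greatest {n p : ℕ} [NeZero p] (a : Fin p → Fin n → ℝ) (c : Fin p → ℝ)
    (x μ : Fin n → ℝ) : ∃ M, IsGreatest {t : ℝ | ∃ κ ∈ iotaA a c x, t = μ ⬝ᵥ a κ} M := by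
  obtain ⟨i, hi⟩ := iota_nonempty a c x
  obtain ⟨k, hk, hmax⟩ := Set.exists_max_image (iotaA a c x) (fun κ => μ ⬝ᵥ a κ)
    (Set.toFinite _) ⟨i, hi⟩
  refine ⟨_, ⟨k, hk, rfl⟩, ?_⟩
  rintro t ⟨κ, hκ, rfl⟩
  exact hmax κ hκ

/-- Subgradients of `pwa` are convex combinations of the active vectors. -/
lemma exists_weights {n p : ℕ} [NeZero p] (a : Fin p → Fin n → ℝ) (c : Fin p → ℝ)
    (x y : Fin n → ℝ) (h : ∀ z, pwa a c x + y ⬝ᵥ (z - x) ≤ pwa a c z) :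
    ∃ u : Fin p → ℝ, (∀ j, 0 ≤ u j) ∧ (∀ j, j ∉ iotaA a c x → u j = 0) ∧
        (∑ j, u j) = 1 ∧ y = ∑ j, u j • a j := by
  let K0 : Set (Fin p → ℝ) := stdSimplex ℝ (Fin p) ∩ {u | ∀ j, j ∉ iotaA a c x → u j = 0}
  let f : (Fin p → ℝ) →ₗ[ℝ] (Fin n → ℝ) :=
    ∑ j, (LinearMap.proj j : (Fin p → ℝ) →ₗ[ℝ] ℝ).smulRight (a j)
  have hf : ∀ u, f u = ∑ j, u j • a j := by
    intro u
    simp [f]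
  have hfc : Continuous f := f.continuous_of_finiteDimensional
  have hcl : IsClosed {u : Fin p → ℝ | ∀ j, j ∉ iotaA a c x → u j = 0} := by
    simp only [Set.ofPred_forall]
    exact isClosed_iInter fun j => isClosed_iInter fun _ =>
      isClosed_eq (continuous_apply j) continuous_const
  have hK0c : IsCompact K0 := (isCompact_stdSimplex ℝ (Fin p)).inter_right hcl
  have hK0v : Convex ℝ K0 := by
    refine (convex_stdSimplex ℝ (Fin p)).inter ?_
    intro u hu v hv α β _ _ _ j hj
    simp [hu j hj, hv j hj]
  by_cases hy : y ∈ f '' K0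
  · obtain ⟨u, ⟨hu1, hu2⟩, hu3⟩ := hy
    exact ⟨u, hu1.1, hu2, hu1.2, by rw [← hu3, hf]⟩
  exfalso
  obtain ⟨g, s, hg1, hg2⟩ := geometric_hahn_banach_closed_point (hK0v.linear_image f)
    (hK0c.image hfc).isClosed hy
  let e : Fin n → ℝ := fun i => g (Pi.single i 1)
  have hge : ∀ v : Fin n → ℝ, g v = e ⬝ᵥ v := by
    intro v
    conv_lhs => rw [pi_eq_sum_univ' v]
    simp only [map_sum, map_smul, smul_eq_mul, dotProduct, e]
    refine Finset.sum_congr rfl fun i _ => ?_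
    rw [mul_comm]
  obtain ⟨M, hM⟩ := exists_greatest a c x e
  have ht := pwa_tendsto a c x e (fun t => x + t • e) (fun i => by
    refine tendsto_const_nhds.congr' ?_
    filter_upwards [eventually_mem_nhdsWithin] with t ht
    have : (0:ℝ) < t := ht
    simp [this.ne']) M hM
  have h1 : y ⬝ᵥ e ≤ M := by
    refine ge_of_tendsto ht ?_
    filter_upwards [eventually_mem_nhdsWithin] with t ht
    have ht0 : (0:ℝ) < t := ht
    have h2 := h (x + t • e)
    rw [add_sub_cancel_left, dotProduct_smul, smul_eq_mul] at h2
    rw [le_div_iff₀ ht0]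
    linarith
  obtain ⟨κ, hκ, hMκ⟩ := hM.1
  have h3 : a κ ∈ f '' K0 := by
    refine ⟨Pi.single κ 1, ⟨single_mem_stdSimplex ℝ κ, ?_⟩, ?_⟩
    · intro j hj
      have : j ≠ κ := fun h => hj (h ▸ hκ)
      simp [this]
    · rw [hf]
      simp [Pi.single_apply]
  have h4 := hg1 _ h3
  rw [hge] at h4 hg2
  rw [dotProduct_comm] at h1
  linarith

lemma weight_eq {n p : ℕ} (a : Fin p → Fin n → ℝ) (I : Set (Fin p)) (y d : Fin n → ℝ)
    (M : ℝ) (u : Fin p → ℝ) (h0 : ∀ j, 0 ≤ u j) (hI : ∀ j, j ∉ I → u j = 0)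
    (h1 : (∑ j, u j) = 1) (hy : y = ∑ j, u j • a j) (hle : ∀ j ∈ I, d ⬝ᵥ a j ≤ M) :
    d ⬝ᵥ y ≤ M ∧ (d ⬝ᵥ y = M → ∀ i, 0 < u i → d ⬝ᵥ a i = M) := by
  have e : M - d ⬝ᵥ y = ∑ j, u j * (M - d ⬝ᵥ a j) := by
    rw [hy]
    simp only [dotProduct_sum, dotProduct_smul, smul_eq_mul, mul_sub, Finset.sum_sub_distrib]
    rw [← Finset.sum_mul, h1, one_mul]
  have hnn : ∀ j ∈ Finset.univ, 0 ≤ u j * (M - d ⬝ᵥ a j) := by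
    intro j _
    by_cases hj : j ∈ I
    · exact mul_nonneg (h0 j) (sub_nonneg.mpr (hle j hj))
    · rw [hI j hj, zero_mul]
  refine ⟨by have := Finset.sum_nonneg hnn; linarith, fun h i hi => ?_⟩
  rw [h, sub_self] at e
  have := (Finset.sum_eq_zero_iff_of_nonneg hnn).mp e.symm i (Finset.mem_univ i)
  rcases mul_eq_zero.mp this with h | h <;> linarith

lemma diag_line {n : ℕ} {X H V : Matrix (Fin n) (Fin n) ℝ} (hV : V ∈ OSet X) (t : ℝ) :
    (Vᵀ * (X + t • H) * V).diag = lamVec X + t • (Vᵀ * H * V).diag := by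
  rw [Matrix.mul_add, Matrix.add_mul, lam_eq_diag hV]
  ext i
  simp

lemma mip_eq {n : ℕ} {Y H U : Matrix (Fin n) (Fin n) ℝ} (hY : Y.IsSymm) (hU : U ∈ OSet Y) :
    mip Y H = (Uᵀ * H * U).diag ⬝ᵥ lamVec Y := by
  unfold mip
  rw [hY]
  conv_lhs => rw [hU.2]
  rw [Matrix.mul_assoc, Matrix.mul_assoc, Matrix.trace_mul_comm, Matrix.mul_assoc,
    Matrix.trace, dotProduct_comm]
  simp [dotProduct, Matrix.diagonal_mul]

lemma mem_OSet_mul {n : ℕ} {X V R : Matrix (Fin n) (Fin n) ℝ} (hV : V ∈ OSet X) (hR : Rᵀ * R = 1)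
    (hc : ∀ k l, R k l * lamVec X l = lamVec X k * R k l) : V * R ∈ OSet X := by
  have hc' : R * diagonal (lamVec X) = diagonal (lamVec X) * R := by
    ext k l
    rw [Matrix.mul_diagonal, Matrix.diagonal_mul, hc]
  refine ⟨?_, ?_⟩
  · rw [Matrix.transpose_mul, Matrix.mul_assoc, ← Matrix.mul_assoc Vᵀ, hV.1, Matrix.one_mul, hR]
  · rw [Matrix.transpose_mul, Matrix.mul_assoc V, hc', Matrix.mul_assoc V,
      Matrix.mul_assoc (diagonal _), ← Matrix.mul_assoc R, orth_comm hR, Matrix.one_mul,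
      ← Matrix.mul_assoc]
    exact hV.2

lemma mem_OSet_perm {n : ℕ} {X V : Matrix (Fin n) (Fin n) ℝ} (hV : V ∈ OSet X)
    (σ : Equiv.Perm (Fin n)) (hσ : ∀ k, lamVec X (σ k) = lamVec X k) :
    V.submatrix id σ ∈ OSet X := by
  refine ⟨?_, ?_⟩
  · ext i j
    have := congrFun (congrFun hV.1 (σ i)) (σ j)
    simp only [Matrix.mul_apply, Matrix.transpose_apply, Matrix.submatrix_apply, id] at this ⊢
    rw [this, Matrix.one_apply, Matrix.one_apply]
    simp
  · conv_lhs => rw [hV.2]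
    ext i j
    rw [Matrix.mul_apply, Matrix.mul_apply]
    simp only [Matrix.mul_diagonal, Matrix.transpose_apply, Matrix.submatrix_apply, id]
    rw [← Equiv.sum_comp σ]
    simp only [hσ]

lemma conj_perm {n : ℕ} (V H : Matrix (Fin n) (Fin n) ℝ) (σ : Equiv.Perm (Fin n)) (i j : Fin n) :
    ((V.submatrix id σ)ᵀ * H * (V.submatrix id σ)) i j = (Vᵀ * H * V) (σ i) (σ j) := by
  simp [Matrix.mul_apply]

/-- Rotation in the plane of the columns `i`, `j`. -/
lemma exists_rot {n : ℕ} {V H : Matrix (Fin n) (Fin n) ℝ} (hH : H.IsSymm) {i j : Fin n}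
    (hij : i ≠ j) (c s : ℝ) (hcs : c ^ 2 + s ^ 2 = 1) :
    ∃ V' : Matrix (Fin n) (Fin n) ℝ,
      (∀ X, V ∈ OSet X → lamVec X i = lamVec X j → V' ∈ OSet X) ∧
      ∀ b : Fin n → ℝ, (V'ᵀ * H * V').diag ⬝ᵥ b = (Vᵀ * H * V).diag ⬝ᵥ b +
        (b i - b j) * (s ^ 2 * ((Vᵀ * H * V) j j - (Vᵀ * H * V) i i) +
          2 * c * s * (Vᵀ * H * V) i j) := by
  let r : Fin n → Fin n → ℝ := fun l => if l = i then c • Pi.single i 1 + s • Pi.single j 1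
    else if l = j then (-s) • Pi.single i 1 + c • Pi.single j 1 else Pi.single l 1
  let R : Matrix (Fin n) (Fin n) ℝ := Matrix.of fun k l => r l k
  have hij' : j ≠ i := hij.symm
  have ri : r i = c • Pi.single i 1 + s • Pi.single j 1 := by simp [r]
  have rj : r j = (-s) • Pi.single i 1 + c • Pi.single j 1 := by simp [r, hij']
  have rl : ∀ l, l ≠ i → l ≠ j → r l = Pi.single l 1 := by
    intro l h1 h2; simp [r, h1, h2]
  have hR : Rᵀ * R = 1 := by
    ext k l
    have : (Rᵀ * R) k l = r k ⬝ᵥ r l := rfl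
    rw [this]
    by_cases hk : k = i
    · subst hk
      by_cases hl : l = k
      · subst hl
        rw [ri]; simp [hij, hij']; linarith
      by_cases hl2 : l = j
      · subst hl2
        rw [ri, rj]; simp [hij, hij']; ring
      · rw [ri, rl l hl hl2]; simp [hij, hij', hl, hl2, Ne.symm hl]
    by_cases hk2 : k = j
    · subst hk2
      by_cases hl : l = i
      · subst hl
        rw [ri, rj]; simp [hij, hij']; ring
      by_cases hl2 : l = k
      · subst hl2
        rw [rj]; simp [hij, hij']; linarith
      · rw [rj, rl l hl hl2]; simp [hij, hij', hl, hl2, Ne.symm hl2]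
    · rw [rl k hk hk2]
      by_cases hl : l = i
      · subst hl
        rw [ri]; simp [hk, hk2]
      by_cases hl2 : l = j
      · subst hl2
        rw [rj]; simp [hk, hk2]
      · rw [rl l hl hl2]; simp [Matrix.one_apply, Pi.single_apply, eq_comm]
  refine ⟨V * R, fun X hV hx => mem_OSet_mul hV hR fun k l => ?_, fun b => ?_⟩
  · have : R k l = r l k := rfl
    rw [this]
    by_cases hl : l = i
    · subst hl
      rw [ri]
      by_cases hk : k = l
      · subst hk; ring
      by_cases hk2 : k = j
      · subst hk2; rw [hx]; ring
      · simp [hk, hk2]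
    by_cases hl2 : l = j
    · subst hl2
      rw [rj]
      by_cases hk : k = l
      · subst hk; ring
      by_cases hk2 : k = i
      · subst hk2; rw [hx]; ring
      · simp [hk, hk2]
    · rw [rl l hl hl2]
      by_cases hk : k = l
      · subst hk; ring
      · simp [hk]
  · set D := Vᵀ * H * V with hD
    have hDs : D j i = D i j := by
      have : Dᵀ = D := by
        rw [hD, Matrix.transpose_mul, Matrix.transpose_mul, Matrix.transpose_transpose, hH,
          Matrix.mul_assoc]
      exact congrFun (congrFun this i) j
    have e1 : (V * R)ᵀ * H * (V * R) = Rᵀ * (D * R) := by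
      simp only [hD, Matrix.transpose_mul, Matrix.mul_assoc]
    set δ := s ^ 2 * (D j j - D i i) + 2 * c * s * D i j with hδ
    have e2 : ∀ l, (Rᵀ * (D * R)) l l = D l l + (if l = i then δ else 0) +
        (if l = j then -δ else 0) := by
      intro l
      have : (Rᵀ * (D * R)) l l = r l ⬝ᵥ (D *ᵥ r l) := rfl
      rw [this]
      by_cases hl : l = i
      · subst hl
        rw [ri, if_pos rfl, if_neg hij]
        simp only [Matrix.mulVec_add, Matrix.mulVec_smul, add_dotProduct, smul_dotProduct,
          dotProduct_add, dotProduct_smul, single_one_dotProduct, Matrix.mulVec_single_one,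
          Matrix.col_apply, smul_eq_mul, hDs]
        rw [hδ]
        linear_combination D l l * hcs
      by_cases hl2 : l = j
      · subst hl2
        rw [rj, if_pos rfl, if_neg hij']
        simp only [Matrix.mulVec_add, Matrix.mulVec_smul, add_dotProduct, smul_dotProduct,
          dotProduct_add, dotProduct_smul, single_one_dotProduct, Matrix.mulVec_single_one,
          Matrix.col_apply, smul_eq_mul, hDs]
        rw [hδ]
        linear_combination D l l * hcs
      · rw [rl l hl hl2, if_neg hl, if_neg hl2]
        simp
    rw [e1]
    simp only [dotProduct, Matrix.diag_apply, e2, add_mul, Finset.sum_add_distrib, ite_mul,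
      zero_mul, Finset.sum_ite_eq', Finset.mem_univ, if_true]
    ring

lemma quad_zero (P Q : ℝ) (h : ∀ c s : ℝ, c ^ 2 + s ^ 2 = 1 → s ^ 2 * P + 2 * c * s * Q ≤ 0) :
    Q = 0 := by
  by_contra hQ
  have hQ2 : 0 < Q ^ 2 := by positivity
  set m := |P| + 1 with hm
  have hm0 : 0 < m := by positivity
  set N := Real.sqrt (m ^ 2 + Q ^ 2) with hN
  have hNpos : 0 < N := Real.sqrt_pos.mpr (by positivity)
  have hN2 : N ^ 2 = m ^ 2 + Q ^ 2 := Real.sq_sqrt (by positivity)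
  have := h (m / N) (Q / N) (by
    rw [div_pow, div_pow, ← add_div, hN2]
    exact div_self (by positivity))
  have e : (Q / N) ^ 2 * P + 2 * (m / N) * (Q / N) * Q = (Q ^ 2 * (P + 2 * m)) / N ^ 2 := by
    field_simp
  rw [e] at this
  have h2 : 0 < P + 2 * m := by
    have := neg_abs_le P
    have := abs_nonneg P
    linarith
  have : 0 < (Q ^ 2 * (P + 2 * m)) / N ^ 2 := by positivity
  linarith

/-- Proposition 3.2.  Characterization of the critical cone
`C(X̄+Ȳ; ∂θ₁(X̄)) = {H ∈ Sⁿ : θ₁'(X̄;H) = ⟨Ȳ,H⟩}`: a symmetric `H` belongs to it iff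
`⟨diag(ŪᵀHŪ), aⁱ⟩ = ⟨diag(ŪᵀHŪ), aʲ⟩ = max_{κ∈ι₁} ⟨λ'(X̄;H), a^κ⟩` for all
`i,j ∈ η₁(λ(X̄),λ(Ȳ))`; and membership implies conditions (i), (ii), (iii). -/
theorem stmt5 {n p : ℕ} [NeZero p]
    (a : Fin p → Fin n → ℝ) (c : Fin p → ℝ)
    (hsym : ∀ (σ : Equiv.Perm (Fin n)) (x : Fin n → ℝ), pwa a c (x ∘ σ) = pwa a c x)
    (theta1 : Matrix (Fin n) (Fin n) ℝ → ℝ)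
    (htheta1 : theta1 = fun X => pwa a c (lamVec X))
    (Xb : Matrix (Fin n) (Fin n) ℝ) (hXb : Xb.IsSymm)
    (Yb : Matrix (Fin n) (Fin n) ℝ) (hYb : Yb ∈ msubdiff theta1 Xb)
    (Ub : Matrix (Fin n) (Fin n) ℝ) (hUb : Ub ∈ OSet Xb ∩ OSet Yb)
    (H : Matrix (Fin n) (Fin n) ℝ) (hH : H.IsSymm) :
    (dirDeriv theta1 Xb H = mip Yb H ↔
      ∀ i ∈ etaA a c (lamVec Xb) (lamVec Yb), ∀ j ∈ etaA a c (lamVec Xb) (lamVec Yb),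
        (fun z => (Ubᵀ * H * Ub) z z) ⬝ᵥ a i = (fun z => (Ubᵀ * H * Ub) z z) ⬝ᵥ a j ∧
        IsGreatest {t : ℝ | ∃ κ ∈ iotaA a c (lamVec Xb), t = lamDD Xb H ⬝ᵥ a κ}
          ((fun z => (Ubᵀ * H * Ub) z z) ⬝ᵥ a i)) ∧
    (dirDeriv theta1 Xb H = mip Yb H →
      (∀ i j : Fin n, sameA Xb i j → ¬ sameB Xb Yb i j → (Ubᵀ * H * Ub) i j = 0) ∧
      (∀ i ∈ etaA a c (lamVec Xb) (lamVec Yb), ∀ j ∈ etaA a c (lamVec Xb) (lamVec Yb),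
        lamDD Xb H ⬝ᵥ a i = lamDD Xb H ⬝ᵥ a j ∧
        IsGreatest {t : ℝ | ∃ κ ∈ iotaA a c (lamVec Xb), t = lamDD Xb H ⬝ᵥ a κ}
          (lamDD Xb H ⬝ᵥ a i)) ∧
      (∃ ρ : Fin n → ℝ, (∀ i j : Fin n, sameB Xb Yb i j → ρ i = ρ j) ∧
        ∀ i j : Fin n, sameB Xb Yb i j → badB a c Xb Yb i →
          (Ubᵀ * H * Ub) i j = if i = j then ρ i else 0)) := by
  subst htheta1
  set x := lamVec Xb with hx
  set y := lamVec Yb with hy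
  have hYs : Yb.IsSymm := hYb.1
  obtain ⟨M, hM⟩ := exists_greatest a c x (lamDD Xb H)
  have htend : Tendsto (fun t : ℝ => (pwa a c (lamVec (Xb + t • H)) - pwa a c x) / t) (𝓝[>] 0)
      (𝓝 M) :=
    pwa_tendsto a c x (lamDD Xb H) (fun t => lamVec (Xb + t • H)) (lam_tendsto hXb hH) M hM
  have hdir : dirDeriv (fun X => pwa a c (lamVec X)) Xb H = M := htend.limUnder_eq
  rw [hdir]
  -- active pieces are dominated by the directional derivative
  have hact : ∀ V ∈ OSet Xb, ∀ w ∈ iotaA a c x, (Vᵀ * H * V).diag ⬝ᵥ a w ≤ M := by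
    intro V hV w hw
    refine ge_of_tendsto htend ?_
    filter_upwards [eventually_mem_nhdsWithin] with t ht
    have ht0 : (0:ℝ) < t := ht
    have h1 := pwa_diag_le_lam hsym (symm_line hXb hH t) hV.1
    rw [diag_line hV] at h1
    have h2 := le_pwa a c (lamVec Xb + t • (Vᵀ * H * V).diag) w
    rw [dotProduct_add, dotProduct_smul, smul_eq_mul, dotProduct_comm (a w) (Matrix.diag _)] at h2
    have h3 : a w ⬝ᵥ lamVec Xb - c w = pwa a c x := hw
    rw [le_div_iff₀ ht0]
    linarith
  -- weights
  have hwt : ∃ u : Fin p → ℝ, (∀ j, 0 ≤ u j) ∧ (∀ j, j ∉ iotaA a c x → u j = 0) ∧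
        (∑ j, u j) = 1 ∧ y = ∑ j, u j • a j := by
    refine exists_weights a c x y fun z => ?_
    have hUX := hUb.1
    have hUY := hUb.2
    set A := Ub * diagonal z * Ubᵀ with hA
    have hAs : A.IsSymm := by
      unfold Matrix.IsSymm
      rw [hA, Matrix.transpose_mul, Matrix.transpose_mul, Matrix.transpose_transpose,
        Matrix.diagonal_transpose, Matrix.mul_assoc]
    have hUA : Ubᵀ * A * Ub = diagonal z := by
      rw [hA, ← Matrix.mul_assoc, ← Matrix.mul_assoc, hUX.1, Matrix.one_mul, Matrix.mul_assoc,
        hUX.1, Matrix.mul_one]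
    have h1 := hYb.2 A hAs
    rw [mip_eq hYs hUY, Matrix.mul_sub, Matrix.sub_mul, hUA, lam_eq_diag hUX] at h1
    have h2 : pwa a c (lamVec A) ≤ pwa a c z := by
      obtain ⟨W, hW⟩ := exists_OSet hAs
      have e1 := lam_eq_diag hW
      have e2 : lamVec A = ((Ubᵀ * W)ᵀ * diagonal z * (Ubᵀ * W)).diag := by
        have : (Ubᵀ * W)ᵀ * diagonal z * (Ubᵀ * W) = Wᵀ * A * W := by
          rw [hA]
          simp only [Matrix.transpose_mul, Matrix.transpose_transpose, Matrix.mul_assoc]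
        rw [this, e1, Matrix.diag_diagonal]
      rw [e2]
      refine pwa_diag_le hsym ?_ z
      rw [Matrix.transpose_mul, Matrix.transpose_transpose, Matrix.mul_assoc,
        ← Matrix.mul_assoc Ub, orth_comm hUX.1, Matrix.one_mul, hW.1]
    have e3 : (diagonal z - diagonal (lamVec Xb) : Matrix (Fin n) (Fin n) ℝ).diag = z - x := by
      ext k
      simp [hx]
    rw [e3, dotProduct_comm] at h1
    exact h1.trans h2
  obtain ⟨u, hu0, huI, hu1, huy⟩ := hwt
  have hmip : ∀ V ∈ OSet Yb, mip Yb H = (Vᵀ * H * V).diag ⬝ᵥ y := fun V hV => mip_eq hYs hV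
  -- forward direction for every common eigenbasis
  have hfor : M = mip Yb H → ∀ V, V ∈ OSet Xb → V ∈ OSet Yb →
      ∀ w ∈ etaA a c x y, (Vᵀ * H * V).diag ⬝ᵥ a w = M := by
    rintro hcrit V hVX hVY w ⟨u', h0, hI, h1, hy', hpos⟩
    refine (weight_eq a (iotaA a c x) y _ M u' h0 hI h1 hy' (hact V hVX)).2 ?_ w hpos
    rw [hcrit, hmip V hVY]
  have hfan : y ⬝ᵥ (Ubᵀ * H * Ub).diag ≤ y ⬝ᵥ lamDD Xb H := by
    have h1 : Tendsto (fun t : ℝ => ∑ k, y k * ((lamVec (Xb + t • H) k - lamVec Xb k) / t)) (𝓝[>] 0)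
        (𝓝 (∑ k, y k * lamDD Xb H k)) :=
      tendsto_finsetSum _ fun k _ => (lam_tendsto hXb hH k).const_mul _
    refine ge_of_tendsto h1 ?_
    filter_upwards [eventually_mem_nhdsWithin] with t ht
    have ht0 : (0:ℝ) < t := ht
    have h2 := dot_diag_le_lam (symm_line hXb hH t) hUb.1.1 (lam_antitone Yb)
    rw [diag_line hUb.1, dotProduct_add, dotProduct_smul, smul_eq_mul] at h2
    have e : ∑ k, y k * ((lamVec (Xb + t • H) k - lamVec Xb k) / t) =
        (y ⬝ᵥ lamVec (Xb + t • H) - y ⬝ᵥ lamVec Xb) / t := by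
      rw [← dotProduct_sub]
      simp only [dotProduct, Finset.sum_div, Pi.sub_apply]
      exact Finset.sum_congr rfl fun k _ => by ring
    rw [e, le_div_iff₀ ht0]
    linarith
  refine ⟨⟨fun hcrit i hi j hj => ?_, fun h => ?_⟩, fun hcrit => ⟨?_, ?_, ?_⟩⟩
  · have h1 := hfor hcrit Ub hUb.1 hUb.2 i hi
    have h2 := hfor hcrit Ub hUb.1 hUb.2 j hj
    change (Ubᵀ * H * Ub).diag ⬝ᵥ a i = (Ubᵀ * H * Ub).diag ⬝ᵥ a j ∧
      IsGreatest _ ((Ubᵀ * H * Ub).diag ⬝ᵥ a i)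
    rw [h1, h2]
    exact ⟨rfl, hM⟩
  · have hval : ∀ i ∈ etaA a c x y, (Ubᵀ * H * Ub).diag ⬝ᵥ a i = M :=
      fun i hi => (h i hi i hi).2.unique hM
    rw [hmip Ub hUb.2, huy]
    simp only [dotProduct_sum, dotProduct_smul, smul_eq_mul]
    have : ∀ j ∈ Finset.univ, u j * ((Ubᵀ * H * Ub).diag ⬝ᵥ a j) = u j * M := by
      intro j _
      rcases (hu0 j).eq_or_lt with h0 | h0
      · rw [← h0]; simp
      · rw [hval j ⟨u, hu0, huI, hu1, huy, h0⟩]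
    rw [Finset.sum_congr rfl this, ← Finset.sum_mul, hu1, one_mul]
  · intro i j hA hB
    have hxij : lamVec Xb i = lamVec Xb j := hA
    have hyij : y i ≠ y j := fun h => hB ⟨hxij, h⟩
    have hij : i ≠ j := fun h => hyij (by rw [h])
    have hq : (y i - y j) * (Ubᵀ * H * Ub) i j = 0 := by
      refine quad_zero ((y i - y j) * ((Ubᵀ * H * Ub) j j - (Ubᵀ * H * Ub) i i)) _ ?_
      intro c' s' hcs
      obtain ⟨V, hV1, hV2⟩ := exists_rot (V := Ub) hH hij c' s' hcs
      have h1 := (weight_eq a (iotaA a c x) y _ M u hu0 huI hu1 huy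
        (hact V (hV1 Xb hUb.1 hxij))).1
      rw [hV2 y, ← hmip Ub hUb.2, ← hcrit] at h1
      linarith
    exact (mul_eq_zero.mp hq).resolve_left (sub_ne_zero.mpr hyij)
  · have hle : ∀ w ∈ iotaA a c x, lamDD Xb H ⬝ᵥ a w ≤ M := fun w hw => hM.2 ⟨w, hw, rfl⟩
    have hyM : lamDD Xb H ⬝ᵥ y = M := by
      refine le_antisymm (weight_eq a (iotaA a c x) y _ M u hu0 huI hu1 huy hle).1 ?_
      rw [hcrit, hmip Ub hUb.2, dotProduct_comm, dotProduct_comm _ y]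
      exact hfan
    have hval : ∀ w ∈ etaA a c x y, lamDD Xb H ⬝ᵥ a w = M := by
      rintro w ⟨u', h0, hI, h1, hy', hpos⟩
      exact (weight_eq a (iotaA a c x) y _ M u' h0 hI h1 hy' hle).2 hyM w hpos
    intro i hi j hj
    rw [hval i hi, hval j hj]
    exact ⟨rfl, hM⟩
  · have hbad : ∀ i j, i ≠ j → sameB Xb Yb i j → badB a c Xb Yb i →
        (Ubᵀ * H * Ub) i j = 0 ∧ (Ubᵀ * H * Ub) i i = (Ubᵀ * H * Ub) j j := by
      rintro i j hij hB ⟨z, z', hz, hz', w, hw, hne⟩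
      have hzz : z ≠ z' := fun h => hne (by rw [h])
      have hsw : ∀ (v : Fin n → ℝ) (p q : Fin n), v p = v q → ∀ k, v (Equiv.swap p q k) = v k := by
        intro v p q h k
        rcases eq_or_ne k p with rfl | hp
        · rw [Equiv.swap_apply_left, h]
        rcases eq_or_ne k q with rfl | hq
        · rw [Equiv.swap_apply_right, h]
        · rw [Equiv.swap_apply_of_ne_of_ne hp hq]
      let σ : Equiv.Perm (Fin n) := (Equiv.swap z i).trans (Equiv.swap (Equiv.swap z i z') j)
      have hσ : ∀ v : Fin n → ℝ, v z = v i → v z' = v i → v i = v j → ∀ k, v (σ k) = v k := by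
        intro v h1 h2 h3 k
        show v (Equiv.swap (Equiv.swap z i z') j (Equiv.swap z i k)) = v k
        rw [hsw v _ _ (by rw [hsw v z i h1, h2, h3]), hsw v z i h1]
      have hσz : σ z = i := by
        show Equiv.swap (Equiv.swap z i z') j (Equiv.swap z i z) = i
        rw [Equiv.swap_apply_left, Equiv.swap_apply_of_ne_of_ne _ hij]
        intro h
        apply hzz
        apply (Equiv.swap z i).injective
        rw [Equiv.swap_apply_left]
        exact h
      have hσz' : σ z' = j := by
        show Equiv.swap (Equiv.swap z i z') j (Equiv.swap z i z') = j
        rw [Equiv.swap_apply_left]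
      have hVX := mem_OSet_perm hUb.1 σ (hσ (lamVec Xb) hz.1 hz'.1 hB.1)
      have hVY := mem_OSet_perm hUb.2 σ (hσ (lamVec Yb) hz.2 hz'.2 hB.2)
      have h0 := hfor hcrit _ hVX hVY w hw
      have hrot : ∀ c' s' : ℝ, c' ^ 2 + s' ^ 2 = 1 →
          s' ^ 2 * ((Ubᵀ * H * Ub) j j - (Ubᵀ * H * Ub) i i) +
            2 * c' * s' * (Ubᵀ * H * Ub) i j = 0 := by
        intro c' s' hcs
        obtain ⟨V, hV1, hV2⟩ := exists_rot (V := Ub.submatrix id σ) hH hzz c' s' hcs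
        have h1 := hfor hcrit V (hV1 Xb hVX (hz.1.trans hz'.1.symm))
          (hV1 Yb hVY (hz.2.trans hz'.2.symm)) w hw
        rw [hV2, h0, conj_perm, conj_perm, conj_perm, hσz, hσz'] at h1
        have h2 := add_eq_left.mp h1
        exact (mul_eq_zero.mp h2).resolve_left (sub_ne_zero.mpr hne)
      have r1 := hrot 0 1 (by norm_num)
      have r2 := hrot (3/5) (4/5) (by norm_num)
      constructor <;> linarith
    have hinv : ∀ i j, sameB Xb Yb i j → badB a c Xb Yb i → badB a c Xb Yb j := by
      rintro i j hB ⟨z, z', hz, hz', hw⟩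
      exact ⟨z, z', ⟨hz.1.trans hB.1, hz.2.trans hB.2⟩, ⟨hz'.1.trans hB.1, hz'.2.trans hB.2⟩, hw⟩
    refine ⟨fun i => if badB a c Xb Yb i then (Ubᵀ * H * Ub) i i else 0, ?_, ?_⟩
    · intro i j hB
      rcases eq_or_ne i j with rfl | hij
      · rfl
      dsimp only
      by_cases hb : badB a c Xb Yb i
      · rw [if_pos hb, if_pos (hinv i j hB hb)]
        exact (hbad i j hij hB hb).2
      · have : ¬ badB a c Xb Yb j := fun h => hb (hinv j i ⟨hB.1.symm, hB.2.symm⟩ h)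
        rw [if_neg hb, if_neg this]
    · intro i j hB hb
      rcases eq_or_ne i j with rfl | hij
      · rw [if_pos rfl]
        exact (if_pos hb).symm
      · rw [if_neg hij]
        exact (hbad i j hij hB hb).1

end
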